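/- arXiv:2103.14325 — 8 statements merged into one kernel-verified Lean document; each statement's English description precedes it below -/
import Mathlib

section
/- Let P be a complex m×m matrix with P* = P and P² = P, and let R be a complex m×m matrix with R* = R and P R (I − P) = 0. Then a Hermitian m×m matrix X (X* = X) satisfies P X + X P − X = R if and only if X = −R + P R + R P + Y + Y* for some complex m×m matrix Y satisfying Y = P Y (I − P). (This is Lemma 3.1 of the paper, describing the general solution of the system arising in the construction of a single pseudodifferential projection.) -/
open Matrix

/-- Lemma 3.1 of the paper: the general solution of the system
`P X + X P − X = R`, `X* = X`, given a Hermitian idempotent `P` and a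
Hermitian `R` with `P R (I − P) = 0`, is
`X = −R + P R + R P + Y + Y*` with `Y = P Y (I − P)`. -/
theorem general_solution_single_projection_step
    (m : ℕ) (hm : 2 ≤ m)
    (P R X : Matrix (Fin m) (Fin m) ℂ)
    (hP_herm : Pᴴ = P) (hP_idem : P * P = P)
    (hR_herm : Rᴴ = R) (hR_solv : P * R * (1 - P) = 0)
    (hX_herm : Xᴴ = X) :
    P * X + X * P - X = R ↔
      ∃ Y : Matrix (Fin m) (Fin m) ℂ,
        Y = P * Y * (1 - P) ∧ X = -R + P * R + R * P + Y + Yᴴ := by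
  constructor
  · rintro rfl
    refine ⟨P * X * (1 - P), ?_, ?_⟩
    · have h : (1 - P) * (1 - P) = 1 - P := by
        simp [mul_sub, sub_mul, hP_idem]
      simp only [mul_assoc, h]
      simp only [← mul_assoc, hP_idem]
    · have h : P * (P * X) = P * X := by rw [← mul_assoc, hP_idem]
      simp only [conjTranspose_mul, conjTranspose_sub, hP_herm, hX_herm,
        mul_sub, mul_add, sub_mul, add_mul, mul_one, mul_assoc, hP_idem, h]
      abel
  · rintro ⟨Y, hY, rfl⟩
    have hPY : P * Y = Y := by
      rw [hY]
      simp only [← mul_assoc, hP_idem]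
    have hYP : Y * P = 0 := by
      rw [hY, mul_assoc, sub_mul, one_mul, hP_idem, sub_self, mul_zero]
    have hYhP : Yᴴ * P = Yᴴ := by
      simpa [hP_herm] using congrArg conjTranspose hPY
    have hPYh : P * Yᴴ = 0 := by
      simpa [hP_herm] using congrArg conjTranspose hYP
    have hPR : P * R = P * R * P := by
      rwa [mul_sub, mul_one, sub_eq_zero] at hR_solv
    have hRP : R * P = P * R * P := by
      simpa [hP_herm, hR_herm, mul_assoc] using congrArg conjTranspose hPR
    have hcomm : R * P = P * R := hRP.trans hPR.symm
    have h : P * (P * R) = P * R := by rw [← mul_assoc, hP_idem]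
    have h' : P * R * P = P * R := hPR.symm
    simp only [mul_add, add_mul, mul_neg, neg_mul, hPY, hYP, hYhP, hPYh, hcomm, h, h']
    abel
end

section
/- Let P⁽¹⁾,…,P⁽ᵐ⁾ be an orthonormal family of projections and let R_{j,l} (for all pairs j ≠ l) be complex m×m matrices satisfying R_{j,l} = P⁽ʲ⁾ R_{j,l} P⁽ˡ⁾ and (R_{j,l})* = R_{l,j}. Then a family of matrices Y_{j,l} (j ≠ l) satisfying Y_{j,l} = P⁽ʲ⁾ Y_{j,l} P⁽ˡ⁾ solves the system ∑_{l≠j} P⁽ⁿ⁾ (Y_{j,l} + (Y_{j,l})*) + ∑_{l≠n} (Y_{n,l} + (Y_{n,l})*) P⁽ʲ⁾ = R_{n,j} for every pair n ≠ j, if and only if Y_{j,l} = (1/2) R_{j,l} + Z_{j,l} for some family of matrices Z_{j,l} (j ≠ l) satisfying Z_{j,l} = P⁽ʲ⁾ Z_{j,l} P⁽ˡ⁾ and (Z_{j,l})* = −Z_{l,j}. (This is Lemma 3.3 of the paper, describing the general solution of the system arising in the construction of a basis of pseudodifferential projections.) -/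
open Matrix Finset

section PeirceDecomposition

variable {ι n α : Type*} [Fintype n] [NonUnitalSemiring α] [StarRing α]
  {P : ι → Matrix n n α} {Y : ι → ι → Matrix n n α}

/-- Multiplying an off-diagonal block by a projection other than its left one, only the adjoint
part can survive. -/
theorem proj_mul_add_conjTranspose [DecidableEq ι]
    (hP_herm : ∀ j, (P j)ᴴ = P j) (hP_idem : ∀ j, P j * P j = P j)
    (hP_orth : ∀ j l, j ≠ l → P j * P l = 0)
    (hY : ∀ j l, j ≠ l → Y j l = P j * Y j l * P l)
    {k j l : ι} (hkj : k ≠ j) (hlj : l ≠ j) :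
    P k * (Y j l + (Y j l)ᴴ) = if l = k then (Y j k)ᴴ else 0 := by
  have h_left : P k * Y j l = 0 := by
    rw [hY j l hlj.symm, ← mul_assoc, ← mul_assoc, hP_orth k j hkj, zero_mul, zero_mul]
  have h_adj : (Y j l)ᴴ = P l * ((Y j l)ᴴ * P j) := by
    conv_lhs => rw [hY j l hlj.symm]
    simp only [conjTranspose_mul, hP_herm]
  rw [mul_add, h_left, zero_add]
  split_ifs with h
  · subst h
    rw [h_adj, ← mul_assoc, hP_idem]
  · rw [h_adj, ← mul_assoc, hP_orth k l (Ne.symm h), zero_mul]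

/-- The left-hand side of the linear system collapses to two blocks. -/
theorem sum_proj_mul_add_sum_mul_proj [Fintype ι] [DecidableEq ι]
    (hP_herm : ∀ j, (P j)ᴴ = P j) (hP_idem : ∀ j, P j * P j = P j)
    (hP_orth : ∀ j l, j ≠ l → P j * P l = 0)
    (hY : ∀ j l, j ≠ l → Y j l = P j * Y j l * P l)
    {k j : ι} (hkj : k ≠ j) :
    (∑ l ∈ Finset.univ.filter (· ≠ j), P k * (Y j l + (Y j l)ᴴ)) +
      (∑ l ∈ Finset.univ.filter (· ≠ k), (Y k l + (Y k l)ᴴ) * P j) = (Y j k)ᴴ + Y k j := by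
  have h_adj : ∀ l ≠ k, (Y k l + (Y k l)ᴴ) * P j = if l = j then Y k j else 0 := by
    intro l hl
    apply conjTranspose_injective
    rw [conjTranspose_mul, conjTranspose_add, conjTranspose_conjTranspose, hP_herm, add_comm,
      proj_mul_add_conjTranspose hP_herm hP_idem hP_orth hY hkj.symm hl, apply_ite conjTranspose,
      conjTranspose_zero]
  congr 1
  · rw [Finset.sum_congr rfl fun l hl => proj_mul_add_conjTranspose hP_herm hP_idem hP_orth hY hkj
      (Finset.mem_filter.mp hl).2]
    simp [hkj]
  · rw [Finset.sum_congr rfl fun l hl => h_adj l (Finset.mem_filter.mp hl).2]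
    simp [hkj.symm]

end PeirceDecomposition

/-- Lemma 3.3 of the paper: given an orthonormal family of projections `P j` and
matrices `R j l` (`j ≠ l`) with `R j l = P j * R j l * P l` and `(R j l)ᴴ = R l j`,
a family `Y j l` (`j ≠ l`) with `Y j l = P j * Y j l * P l` solves the system
`∑_{l≠j} P n (Y j l + (Y j l)*) + ∑_{l≠n} (Y n l + (Y n l)*) P j = R n j` for all
`n ≠ j` iff `Y j l = (1/2) R j l + Z j l` for some family `Z j l` with
`Z j l = P j * Z j l * P l` and `(Z j l)ᴴ = −Z l j`. -/
theorem general_solution_basis_of_projections_step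
    (m : ℕ) (hm : 2 ≤ m)
    (P : Fin m → Matrix (Fin m) (Fin m) ℂ)
    (hP_herm : ∀ j, (P j)ᴴ = P j)
    (hP_idem : ∀ j, P j * P j = P j)
    (hP_orth : ∀ j l, j ≠ l → P j * P l = 0)
    (hP_sum : ∑ j, P j = 1)
    (R : Fin m → Fin m → Matrix (Fin m) (Fin m) ℂ)
    (hR_sandwich : ∀ j l, j ≠ l → R j l = P j * R j l * P l)
    (hR_herm : ∀ j l, j ≠ l → (R j l)ᴴ = R l j)
    (Y : Fin m → Fin m → Matrix (Fin m) (Fin m) ℂ)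
    (hY_sandwich : ∀ j l, j ≠ l → Y j l = P j * Y j l * P l) :
    (∀ n j, n ≠ j →
        (∑ l ∈ Finset.univ.filter (· ≠ j), P n * (Y j l + (Y j l)ᴴ)) +
        (∑ l ∈ Finset.univ.filter (· ≠ n), (Y n l + (Y n l)ᴴ) * P j) = R n j) ↔
      ∃ Z : Fin m → Fin m → Matrix (Fin m) (Fin m) ℂ,
        (∀ j l, j ≠ l → Z j l = P j * Z j l * P l) ∧
        (∀ j l, j ≠ l → (Z j l)ᴴ = -Z l j) ∧
        (∀ j l, j ≠ l → Y j l = (2⁻¹ : ℂ) • R j l + Z j l) := by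
  have h_sys := fun {k j : Fin m} (hkj : k ≠ j) =>
    sum_proj_mul_add_sum_mul_proj hP_herm hP_idem hP_orth hY_sandwich hkj
  have h_star : star (2⁻¹ : ℂ) = 2⁻¹ := by simp
  constructor
  · intro h
    refine ⟨fun j l => Y j l - (2⁻¹ : ℂ) • R j l, fun j l hjl => ?_, fun j l hjl => ?_,
      fun j l _ => (add_sub_cancel _ _).symm⟩
    · rw [mul_sub, sub_mul, mul_smul_comm, smul_mul_assoc, ← hY_sandwich j l hjl,
        ← hR_sandwich j l hjl]
    · have h_block := h l j hjl.symm
      rw [h_sys hjl.symm] at h_block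
      rw [conjTranspose_sub, conjTranspose_smul, h_star, hR_herm j l hjl,
        eq_sub_of_add_eq h_block]
      module
  · rintro ⟨Z, -, hZ_skew, hYZ⟩ k j hkj
    rw [h_sys hkj, hYZ j k hkj.symm, hYZ k j hkj, conjTranspose_add, conjTranspose_smul, h_star,
      hR_herm j k hkj.symm, hZ_skew j k hkj.symm]
    module
end

section
/- Let P⁽¹⁾,…,P⁽ᵐ⁾ be an orthonormal family of projections and let R_{n,j} (for all pairs n ≠ j) be complex m×m matrices. If there exists a family of matrices Y_{j,l} (j ≠ l) satisfying Y_{j,l} = P⁽ʲ⁾ Y_{j,l} P⁽ˡ⁾ and ∑_{l≠j} P⁽ⁿ⁾ (Y_{j,l} + (Y_{j,l})*) + ∑_{l≠n} (Y_{n,l} + (Y_{n,l})*) P⁽ʲ⁾ = R_{n,j} for every pair n ≠ j, then necessarily R_{n,j} = P⁽ⁿ⁾ R_{n,j} P⁽ʲ⁾ for every pair n ≠ j. (This is the necessary solvability condition established in the proof of Lemma 3.3.) -/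
open Matrix Finset

/-- If `A` is idempotent, `B` is Hermitian, `A * B = 0` and `B * X = X`, then `A * (X + Xᴴ)`
is fixed by the compression `A * · * B`. -/
lemma mul_add_conjTranspose_eq_compression {k : Type*} [Fintype k] {A B X : Matrix k k ℂ}
    (hA : A * A = A) (hB : Bᴴ = B) (hAB : A * B = 0) (hX : B * X = X) :
    A * (X + Xᴴ) = A * (A * (X + Xᴴ)) * B := by
  have hX' : Xᴴ * B = Xᴴ := by
    simpa [conjTranspose_mul, hB] using congrArg conjTranspose hX
  have h0 : A * X = 0 := by
    rw [← hX, ← Matrix.mul_assoc, hAB, Matrix.zero_mul]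
  rw [← Matrix.mul_assoc A A, hA, Matrix.mul_add, h0, zero_add, Matrix.mul_assoc, hX']

/-- The mirror image of `mul_add_conjTranspose_eq_compression`. -/
lemma add_conjTranspose_mul_eq_compression {k : Type*} [Fintype k] {A B X : Matrix k k ℂ}
    (hA : Aᴴ = A) (hB : B * B = B) (hAB : A * B = 0) (hX : A * X = X) :
    (X + Xᴴ) * B = A * ((X + Xᴴ) * B) * B := by
  have hX' : Xᴴ * A = Xᴴ := by
    simpa [conjTranspose_mul, hA] using congrArg conjTranspose hX
  have h0 : Xᴴ * B = 0 := by
    rw [← hX', Matrix.mul_assoc, hAB, Matrix.mul_zero]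
  rw [Matrix.add_mul, h0, add_zero, ← Matrix.mul_assoc, hX, Matrix.mul_assoc, hB]

/-- Necessary solvability condition from the proof of Lemma 3.3: if the system
`∑_{l≠j} P n (Y j l + (Y j l)*) + ∑_{l≠n} (Y n l + (Y n l)*) P j = R n j`
(for all `n ≠ j`) admits a solution `Y j l` with `Y j l = P j * Y j l * P l`,
then `R n j = P n * R n j * P j` for all `n ≠ j`. -/
theorem solvability_condition_basis_of_projections_step
    (m : ℕ) (hm : 2 ≤ m)
    (P : Fin m → Matrix (Fin m) (Fin m) ℂ)
    (hP_herm : ∀ j, (P j)ᴴ = P j)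
    (hP_idem : ∀ j, P j * P j = P j)
    (hP_orth : ∀ j l, j ≠ l → P j * P l = 0)
    (hP_sum : ∑ j, P j = 1)
    (R : Fin m → Fin m → Matrix (Fin m) (Fin m) ℂ)
    (hex : ∃ Y : Fin m → Fin m → Matrix (Fin m) (Fin m) ℂ,
      (∀ j l, j ≠ l → Y j l = P j * Y j l * P l) ∧
      (∀ n j, n ≠ j →
        (∑ l ∈ Finset.univ.filter (· ≠ j), P n * (Y j l + (Y j l)ᴴ)) +
        (∑ l ∈ Finset.univ.filter (· ≠ n), (Y n l + (Y n l)ᴴ) * P j) = R n j)) :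
    ∀ n j, n ≠ j → R n j = P n * R n j * P j := by
  obtain ⟨Y, hY, hR⟩ := hex
  have hPY : ∀ j l, j ≠ l → P j * Y j l = Y j l := fun j l h => by
    rw [hY j l h, ← Matrix.mul_assoc, ← Matrix.mul_assoc, hP_idem]
  intro n j hnj
  rw [← hR n j hnj, Matrix.mul_add, Matrix.add_mul, Matrix.mul_sum, Matrix.sum_mul,
    Matrix.mul_sum, Matrix.sum_mul]
  congr 1 <;> refine Finset.sum_congr rfl fun l hl => ?_
  · exact mul_add_conjTranspose_eq_compression (hP_idem n) (hP_herm j) (hP_orth n j hnj)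
      (hPY j l (Finset.mem_filter.mp hl).2.symm)
  · exact add_conjTranspose_mul_eq_compression (hP_herm n) (hP_idem j) (hP_orth n j hnj)
      (hPY n l (Finset.mem_filter.mp hl).2.symm)
end

section
/- Let P⁽¹⁾,…,P⁽ᵐ⁾ be an orthonormal family of projections. Then a family of complex m×m matrices Z_{j,l} (for all pairs j ≠ l) satisfying Z_{j,l} = P⁽ʲ⁾ Z_{j,l} P⁽ˡ⁾ solves the homogeneous system ∑_{l≠j} P⁽ⁿ⁾ (Z_{j,l} + (Z_{j,l})*) + ∑_{l≠n} (Z_{n,l} + (Z_{n,l})*) P⁽ʲ⁾ = 0 for every pair n ≠ j, if and only if (Z_{j,l})* = −Z_{l,j} for all j ≠ l. (This is the characterization of solutions of the homogeneous system established at the end of the proof of Lemma 3.3.) -/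
open Matrix Finset

/-- If `A = P * A * Q` with `P`, `Q` Hermitian, then `Aᴴ = Q * Aᴴ * P`. -/
theorem conjTranspose_eq_of_sandwich {ι R : Type*} [Fintype ι] [Semiring R] [StarRing R]
    {P Q A : Matrix ι ι R} (hP : Pᴴ = P) (hQ : Qᴴ = Q) (h : A = P * A * Q) :
    Aᴴ = Q * Aᴴ * P := by
  conv_lhs => rw [h]
  rw [conjTranspose_mul, conjTranspose_mul, hP, hQ, Matrix.mul_assoc]

/-- The left-multiplied sum collapses to a single adjoint block. -/
theorem sum_proj_mul_add_conjTranspose {ι κ R : Type*} [Fintype ι] [Fintype κ] [DecidableEq κ]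
    [Semiring R] [StarRing R] {P : κ → Matrix ι ι R} (hP_herm : ∀ j, (P j)ᴴ = P j)
    (hP_idem : ∀ j, P j * P j = P j) (hP_orth : ∀ j l, j ≠ l → P j * P l = 0)
    {Z : κ → κ → Matrix ι ι R} (hZ : ∀ j l, j ≠ l → Z j l = P j * Z j l * P l)
    {n j : κ} (hnj : n ≠ j) :
    ∑ l ∈ Finset.univ.filter (· ≠ j), P n * (Z j l + (Z j l)ᴴ) = (Z j n)ᴴ := by
  have key : ∀ l, l ≠ j → P n * (Z j l + (Z j l)ᴴ) = P n * P l * (Z j l)ᴴ * P j := by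
    intro l hl
    have h₁ : P n * Z j l = 0 := by
      rw [hZ j l hl.symm, ← Matrix.mul_assoc, ← Matrix.mul_assoc, hP_orth n j hnj,
        Matrix.zero_mul, Matrix.zero_mul]
    rw [Matrix.mul_add, h₁, zero_add]
    conv_lhs => rw [conjTranspose_eq_of_sandwich (hP_herm j) (hP_herm l) (hZ j l hl.symm)]
    simp only [Matrix.mul_assoc]
  rw [Finset.sum_eq_single_of_mem n (by simpa using hnj)]
  · rw [key n hnj, hP_idem,
      ← conjTranspose_eq_of_sandwich (hP_herm j) (hP_herm n) (hZ j n hnj.symm)]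
  · intro l hl hln
    rw [key l (by simpa using hl), hP_orth n l hln.symm, Matrix.zero_mul, Matrix.zero_mul]

/-- The right-multiplied sum collapses to a single block. -/
theorem sum_add_conjTranspose_mul_proj {ι κ R : Type*} [Fintype ι] [Fintype κ] [DecidableEq κ]
    [Semiring R] [StarRing R] {P : κ → Matrix ι ι R} (hP_herm : ∀ j, (P j)ᴴ = P j)
    (hP_idem : ∀ j, P j * P j = P j) (hP_orth : ∀ j l, j ≠ l → P j * P l = 0)
    {Z : κ → κ → Matrix ι ι R} (hZ : ∀ j l, j ≠ l → Z j l = P j * Z j l * P l)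
    {n j : κ} (hnj : n ≠ j) :
    ∑ l ∈ Finset.univ.filter (· ≠ n), (Z n l + (Z n l)ᴴ) * P j = Z n j := by
  have h := congrArg conjTranspose
    (sum_proj_mul_add_conjTranspose hP_herm hP_idem hP_orth hZ hnj.symm)
  simpa only [conjTranspose_sum, conjTranspose_mul, conjTranspose_add,
    conjTranspose_conjTranspose, hP_herm, add_comm] using h

/-- Characterization of the solutions of the homogeneous system at the end of
the proof of Lemma 3.3: a family `Z j l` (`j ≠ l`) with `Z j l = P j * Z j l * P l`
solves `∑_{l≠j} P n (Z j l + (Z j l)*) + ∑_{l≠n} (Z n l + (Z n l)*) P j = 0` for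
every pair `n ≠ j` iff `(Z j l)ᴴ = −Z l j` for all `j ≠ l`. -/
theorem homogeneous_solution_basis_of_projections_step
    (m : ℕ) (hm : 2 ≤ m)
    (P : Fin m → Matrix (Fin m) (Fin m) ℂ)
    (hP_herm : ∀ j, (P j)ᴴ = P j)
    (hP_idem : ∀ j, P j * P j = P j)
    (hP_orth : ∀ j l, j ≠ l → P j * P l = 0)
    (hP_sum : ∑ j, P j = 1)
    (Z : Fin m → Fin m → Matrix (Fin m) (Fin m) ℂ)
    (hZ_sandwich : ∀ j l, j ≠ l → Z j l = P j * Z j l * P l) :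
    (∀ n j, n ≠ j →
        (∑ l ∈ Finset.univ.filter (· ≠ j), P n * (Z j l + (Z j l)ᴴ)) +
        (∑ l ∈ Finset.univ.filter (· ≠ n), (Z n l + (Z n l)ᴴ) * P j) = 0) ↔
      (∀ j l, j ≠ l → (Z j l)ᴴ = -Z l j) := by
  have key : ∀ n j, n ≠ j →
      (∑ l ∈ Finset.univ.filter (· ≠ j), P n * (Z j l + (Z j l)ᴴ)) +
        (∑ l ∈ Finset.univ.filter (· ≠ n), (Z n l + (Z n l)ᴴ) * P j) = (Z j n)ᴴ + Z n j :=
    fun n j hnj => congrArg₂ (· + ·)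
      (sum_proj_mul_add_conjTranspose hP_herm hP_idem hP_orth hZ_sandwich hnj)
      (sum_add_conjTranspose_mul_proj hP_herm hP_idem hP_orth hZ_sandwich hnj)
  constructor
  · intro h j l hjl
    exact eq_neg_of_add_eq_zero_left ((key l j hjl.symm).symm.trans (h l j hjl.symm))
  · intro h n j hnj
    rw [key n j hnj, h j n hnj.symm, neg_add_cancel]
end

section
/- Let P⁽¹⁾,…,P⁽ᵐ⁾ be an orthonormal family of projections and let h⁽¹⁾,…,h⁽ᵐ⁾ be pairwise distinct real numbers. Let M₁,…,M_m be complex m×m matrices satisfying (M_j)* = −M_j, P⁽ʲ⁾ M_j P⁽ʲ⁾ = 0, P⁽ʳ⁾ M_j P⁽ⁿ⁾ = 0 for all r, n ≠ j, and P⁽ˡ⁾ M_l P⁽ʲ⁾ = −P⁽ˡ⁾ M_j P⁽ʲ⁾ for all j ≠ l. Then the matrices Z_{j,l} := −(h⁽ʲ⁾ − h⁽ˡ⁾)⁻¹ P⁽ʲ⁾ M_j P⁽ˡ⁾ (j ≠ l) satisfy Z_{j,l} = P⁽ʲ⁾ Z_{j,l} P⁽ˡ⁾, (Z_{j,l})*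 = −Z_{l,j}, and ∑_{l≠j} (h⁽ʲ⁾ − h⁽ˡ⁾)(Z_{j,l} + Z_{l,j}) = −M_j for every j. (This is Lemma 3.6 of the paper, solving the system that imposes commutation of the pseudodifferential projections with the elliptic operator A.) -/
open Matrix Finset

/-- A matrix whose diagonal blocks with respect to the complementary pair
`p j`, `∑ l ≠ j, p l` vanish is the sum of its off-diagonal blocks. -/
theorem sum_offDiag_blocks_eq {ι R : Type*} [Fintype ι] [DecidableEq ι] [Ring R]
    (p : ι → R) (hp : ∑ i, p i = 1) (a : R) (j : ι) (hdiag : p j * a * p j = 0)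
    (hoff : ∀ r n, r ≠ j → n ≠ j → p r * a * p n = 0) :
    ∑ l ∈ univ.filter (· ≠ j), (p j * a * p l + p l * a * p j) = a := by
  set q := ∑ l ∈ univ.filter (· ≠ j), p l with hq
  have hpq : p j + q = 1 := by
    rw [← hp, hq, filter_ne', add_sum_erase _ _ (mem_univ j)]
  have hqq : q * a * q = 0 := by
    rw [hq, sum_mul, sum_mul_sum]
    exact sum_eq_zero fun r hr => sum_eq_zero fun n hn =>
      hoff r n (mem_filter.1 hr).2 (mem_filter.1 hn).2
  calc ∑ l ∈ univ.filter (· ≠ j), (p j * a * p l + p l * a * p j)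
      = p j * a * q + q * a * p j := by
        rw [sum_add_distrib, ← mul_sum, ← sum_mul, ← sum_mul]
    _ = (p j + q) * a * (p j + q) := by
        simp only [add_mul, mul_add, hdiag, hqq]
        abel
    _ = a := by rw [hpq, one_mul, mul_one]

/-- Lemma 3.6 of the paper: given an orthonormal family of projections `P j`,
pairwise distinct reals `h j`, and matrices `M j` with `(M j)ᴴ = −M j`,
`P j M j P j = 0`, `P r M j P n = 0` for `r, n ≠ j`, and
`P l M l P j = −P l M j P j` for `j ≠ l`, the matrices
`Z j l = −(h j − h l)⁻¹ P j M j P l` satisfy `Z j l = P j Z j l P l`,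
`(Z j l)ᴴ = −Z l j`, and `∑_{l≠j} (h j − h l)(Z j l + Z l j) = −M j`. -/
theorem solution_commutation_system
    (m : ℕ) (hm : 2 ≤ m)
    (P : Fin m → Matrix (Fin m) (Fin m) ℂ)
    (hP_herm : ∀ j, (P j)ᴴ = P j)
    (hP_idem : ∀ j, P j * P j = P j)
    (hP_orth : ∀ j l, j ≠ l → P j * P l = 0)
    (hP_sum : ∑ j, P j = 1)
    (h : Fin m → ℝ) (h_inj : Function.Injective h)
    (M : Fin m → Matrix (Fin m) (Fin m) ℂ)
    (hM_skew : ∀ j, (M j)ᴴ = -M j)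
    (hM_diag : ∀ j, P j * M j * P j = 0)
    (hM_off : ∀ j r n, r ≠ j → n ≠ j → P r * M j * P n = 0)
    (hM_sym : ∀ j l, j ≠ l → P l * M l * P j = -(P l * M j * P j))
    (Z : Fin m → Fin m → Matrix (Fin m) (Fin m) ℂ)
    (hZ_def : ∀ j l, j ≠ l →
      Z j l = -(((h j - h l : ℝ) : ℂ)⁻¹ • (P j * M j * P l))) :
    (∀ j l, j ≠ l → Z j l = P j * Z j l * P l) ∧
    (∀ j l, j ≠ l → (Z j l)ᴴ = -Z l j) ∧
    (∀ j, ∑ l ∈ Finset.univ.filter (· ≠ j),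
        ((h j - h l : ℝ) : ℂ) • (Z j l + Z l j) = -M j) := by
  have hne : ∀ j l, j ≠ l → ((h j - h l : ℝ) : ℂ) ≠ 0 := fun j l hjl =>
    Complex.ofReal_ne_zero.2 (sub_ne_zero.2 (h_inj.ne hjl))
  have hswap : ∀ j l, j ≠ l →
      Z l j = -(((h j - h l : ℝ) : ℂ)⁻¹ • (P l * M j * P j)) := by
    intro j l hjl
    rw [hZ_def l j hjl.symm, hM_sym j l hjl, ← neg_sub (h j) (h l), Complex.ofReal_neg,
      inv_neg, neg_smul_neg]
  refine ⟨fun j l hjl => ?_, fun j l hjl => ?_, fun j => ?_⟩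
  · have hblock : P j * (P j * M j * P l) * P l = P j * M j * P l := by
      rw [← mul_assoc, ← mul_assoc, hP_idem, mul_assoc, hP_idem]
    rw [hZ_def j l hjl, mul_neg, neg_mul, mul_smul_comm, smul_mul_assoc, hblock]
  · rw [hswap j l hjl, hZ_def j l hjl]
    simp [conjTranspose_mul, hP_herm, hM_skew, mul_assoc]
  · rw [← sum_offDiag_blocks_eq P hP_sum (M j) j (hM_diag j) (hM_off j), ← sum_neg_distrib]
    refine sum_congr rfl fun l hl => ?_
    have hjl : j ≠ l := (mem_filter.1 hl).2.symm
    rw [hZ_def j l hjl, hswap j l hjl, ← neg_add, ← smul_add, smul_neg,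
      smul_inv_smul₀ (hne j l hjl)]
end

section
/- Let P⁽¹⁾,…,P⁽ᵐ⁾ be an orthonormal family of projections and let h⁽¹⁾,…,h⁽ᵐ⁾ be pairwise distinct real numbers. If a family of complex m×m matrices Z_{j,l} (for all pairs j ≠ l) satisfies Z_{j,l} = P⁽ʲ⁾ Z_{j,l} P⁽ˡ⁾ and the homogeneous system ∑_{l≠j} (h⁽ʲ⁾ − h⁽ˡ⁾)(Z_{j,l} + Z_{l,j}) = 0 for every j, then Z_{j,l} = 0 for all j ≠ l. (This is Proposition 3.7 of the paper, yielding uniqueness of the solution found in Lemma 3.6.) -/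
open Matrix Finset

/-- Proposition 3.7 of the paper: given an orthonormal family of projections
`P j` and pairwise distinct reals `h j`, any family `Z j l` (`j ≠ l`) with
`Z j l = P j Z j l P l` solving the homogeneous system
`∑_{l≠j} (h j − h l)(Z j l + Z l j) = 0` (for every `j`) vanishes identically. -/
theorem uniqueness_commutation_system
    (m : ℕ) (hm : 2 ≤ m)
    (P : Fin m → Matrix (Fin m) (Fin m) ℂ)
    (hP_herm : ∀ j, (P j)ᴴ = P j)
    (hP_idem : ∀ j, P j * P j = P j)
    (hP_orth : ∀ j l, j ≠ l → P j * P l = 0)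
    (hP_sum : ∑ j, P j = 1)
    (h : Fin m → ℝ) (h_inj : Function.Injective h)
    (Z : Fin m → Fin m → Matrix (Fin m) (Fin m) ℂ)
    (hZ_sandwich : ∀ j l, j ≠ l → Z j l = P j * Z j l * P l)
    (hZ_hom : ∀ j, ∑ l ∈ Finset.univ.filter (· ≠ j),
        ((h j - h l : ℝ) : ℂ) • (Z j l + Z l j) = 0) :
    ∀ j l, j ≠ l → Z j l = 0 := by
  intro j l hjl
  have cut_self : P j * Z j l * P l = Z j l := (hZ_sandwich j l hjl).symm
  have cut_other : ∀ k, k ≠ j → k ≠ l → P j * Z j k * P l = 0 := by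
    intro k hkj hkl
    rw [hZ_sandwich j k hkj.symm]
    simp only [Matrix.mul_assoc, hP_orth k l hkl, Matrix.mul_zero]
  have cut_swap : ∀ k, k ≠ j → P j * Z k j * P l = 0 := by
    intro k hkj
    rw [hZ_sandwich k j hkj]
    simp only [Matrix.mul_assoc, hP_orth j l hjl, Matrix.mul_zero]
  have key : ((h j - h l : ℝ) : ℂ) • Z j l = 0 := by
    have hcut := congrArg (fun A => P j * A * P l) (hZ_hom j)
    simp only [Matrix.mul_sum, Matrix.sum_mul, Matrix.mul_zero, Matrix.zero_mul,
      Matrix.mul_smul, Matrix.smul_mul, Matrix.mul_add, Matrix.add_mul] at hcut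
    rw [Finset.sum_eq_single_of_mem l (by simpa using hjl.symm)] at hcut
    · rwa [cut_self, cut_swap l hjl.symm, add_zero] at hcut
    · intro k hk hkl
      have hkj : k ≠ j := by simpa using hk
      rw [cut_other k hkj hkl, cut_swap k hkj, add_zero, smul_zero]
  refine (smul_eq_zero.mp key).resolve_left ?_
  exact_mod_cast sub_ne_zero.mpr (h_inj.ne hjl)
end

section
/- Let P⁽¹⁾,…,P⁽ᵐ⁾ be an orthonormal family of projections and let h⁽¹⁾,…,h⁽ᵐ⁾ be pairwise distinct real numbers. Fix an index j and let T be a complex m×m matrix with T* = −T and T = ∑_{l≠j} (P⁽ʲ⁾ T P⁽ˡ⁾ + P⁽ˡ⁾ T P⁽ʲ⁾). Then the family Y_l := (h⁽ʲ⁾ − h⁽ˡ⁾)⁻¹ P⁽ʲ⁾ T P⁽ˡ⁾ (l ≠ j) satisfies Y_l = P⁽ʲ⁾ Y_l P⁽ˡ⁾ and ∑_{l≠j} (h⁽ʲ⁾ − h⁽ˡ⁾)(Y_l − (Y_l)*) = T, and it is the unique family with these two properties: if matrices Y'_l (l ≠ j) satisfy Y'_l = P⁽ʲ⁾ Y'_l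 P⁽ˡ⁾ and ∑_{l≠j} (h⁽ʲ⁾ − h⁽ˡ⁾)(Y'_l − (Y'_l)*) = T, then Y'_l = Y_l for all l ≠ j. (This is Lemma 4.2 of the paper, underlying the simplified construction algorithm.) -/
open Matrix Finset

/-- If `A = P * A * Q` with `Q` Hermitian and `P * Q = 0`, then `P * Aᴴ = 0`. -/
theorem mul_conjTranspose_eq_zero_of_block {n R : Type*} [Fintype n]
    [NonUnitalSemiring R] [StarRing R] {P Q A : Matrix n n R} (hQ : Qᴴ = Q) (hPQ : P * Q = 0)
    (hA : A = P * A * Q) : P * Aᴴ = 0 := by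
  rw [hA, conjTranspose_mul, hQ, ← Matrix.mul_assoc, hPQ, Matrix.zero_mul]

/-- Lemma 4.2 of the paper: given an orthonormal family of projections `P l`,
pairwise distinct reals `h l`, a fixed index `j`, and `T` with `Tᴴ = −T` and
`T = ∑_{l≠j} (P j T P l + P l T P j)`, the family
`Y l = (h j − h l)⁻¹ P j T P l` (`l ≠ j`) satisfies `Y l = P j Y l P l` and
`∑_{l≠j} (h j − h l)(Y l − (Y l)ᴴ) = T`, and is the unique such family. -/
theorem solution_simplified_commutation_system
    (m : ℕ) (hm : 2 ≤ m)
    (P : Fin m → Matrix (Fin m) (Fin m) ℂ)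
    (hP_herm : ∀ j, (P j)ᴴ = P j)
    (hP_idem : ∀ j, P j * P j = P j)
    (hP_orth : ∀ j l, j ≠ l → P j * P l = 0)
    (hP_sum : ∑ j, P j = 1)
    (h : Fin m → ℝ) (h_inj : Function.Injective h)
    (j : Fin m)
    (T : Matrix (Fin m) (Fin m) ℂ)
    (hT_skew : Tᴴ = -T)
    (hT_struct : T = ∑ l ∈ Finset.univ.filter (· ≠ j),
        (P j * T * P l + P l * T * P j))
    (Y : Fin m → Matrix (Fin m) (Fin m) ℂ)
    (hY_def : ∀ l, l ≠ j →
      Y l = ((h j - h l : ℝ) : ℂ)⁻¹ • (P j * T * P l)) :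
    (∀ l, l ≠ j → Y l = P j * Y l * P l) ∧
    (∑ l ∈ Finset.univ.filter (· ≠ j),
        ((h j - h l : ℝ) : ℂ) • (Y l - (Y l)ᴴ) = T) ∧
    (∀ Y' : Fin m → Matrix (Fin m) (Fin m) ℂ,
      (∀ l, l ≠ j → Y' l = P j * Y' l * P l) →
      (∑ l ∈ Finset.univ.filter (· ≠ j),
          ((h j - h l : ℝ) : ℂ) • (Y' l - (Y' l)ᴴ) = T) →
      ∀ l, l ≠ j → Y' l = Y l) := by
  have hc : ∀ l, l ≠ j → ((h j - h l : ℝ) : ℂ) ≠ 0 := fun l hl =>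
    Complex.ofReal_ne_zero.mpr (sub_ne_zero.mpr (h_inj.ne hl.symm))
  refine ⟨fun l hl => ?_, ?_, fun Y' hY' hsum l hl => ?_⟩
  · rw [hY_def l hl, mul_smul_comm, smul_mul_assoc]
    congr 1
    calc P j * T * P l = (P j * P j) * T * (P l * P l) := by rw [hP_idem, hP_idem]
      _ = P j * (P j * T * P l) * P l := by noncomm_ring
  · conv_rhs => rw [hT_struct]
    refine Finset.sum_congr rfl fun l hl => ?_
    have hl : l ≠ j := (Finset.mem_filter.mp hl).2
    have hstar : (Y l)ᴴ = -(((h j - h l : ℝ) : ℂ)⁻¹ • (P l * T * P j)) := by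
      rw [hY_def l hl, conjTranspose_smul, conjTranspose_mul, conjTranspose_mul, hP_herm, hP_herm,
        hT_skew, star_inv₀, Complex.star_def, Complex.conj_ofReal, neg_mul, mul_neg, smul_neg,
        Matrix.mul_assoc]
    rw [hstar, hY_def l hl, sub_neg_eq_add, ← smul_add, smul_inv_smul₀ (hc l hl)]
  · have key : P j * T * P l = ((h j - h l : ℝ) : ℂ) • Y' l := by
      rw [← hsum, Finset.mul_sum, Finset.sum_mul, Finset.sum_eq_single_of_mem l (by simpa using hl)]
      · rw [mul_smul_comm, smul_mul_assoc, mul_sub, sub_mul, ← hY' l hl,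
          mul_conjTranspose_eq_zero_of_block (hP_herm l) (hP_orth j l hl.symm) (hY' l hl),
          zero_mul, sub_zero]
      · intro k hk hkl
        have hk : k ≠ j := (Finset.mem_filter.mp hk).2
        have hzero : Y' k * P l = 0 := by
          rw [hY' k hk, Matrix.mul_assoc, hP_orth k l hkl, mul_zero]
        rw [mul_smul_comm, smul_mul_assoc, mul_sub, sub_mul, Matrix.mul_assoc, hzero,
          mul_conjTranspose_eq_zero_of_block (hP_herm k) (hP_orth j k hk.symm) (hY' k hk),
          mul_zero, zero_mul, sub_zero, smul_zero]
    rw [hY_def l hl, key, inv_smul_smul₀ (hc l hl)]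
end

section
/- Let P, Q : ℝᵈ × ℝᵈ → Mat(m, ℂ) be continuously differentiable, with P(x,ξ)² = P(x,ξ) and P(x,ξ) Q(x,ξ) = 0 for every (x,ξ). Then at every point P {P,P} Q = 0, where {P,P} := ∑_{α=1}^d (∂_{x^α}P · ∂_{ξ_α}P − ∂_{ξ_α}P · ∂_{x^α}P). (This is the identity P⁽ʲ⁾{P⁽ʲ⁾,P⁽ʲ⁾}P⁽ˡ⁾ = 0 for j ≠ l used in Section 5 in the computation of the subprincipal symbols of the pseudodifferential projections.) -/
open Matrix

attribute [local instance] Matrix.normedAddCommGroup Matrix.normedSpace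

/-- The Leibniz rule for the derivative of an idempotent matrix-function. -/
theorem fderiv_eq_of_idempotent {E : Type*} [NormedAddCommGroup E] [NormedSpace ℝ E] {n : Type*}
    [Fintype n] {P : E → Matrix n n ℂ} {z : E}
    (hP : DifferentiableAt ℝ P z) (hP_idem : ∀ z, P z * P z = P z) (v : E) :
    P z * fderiv ℝ P z v + fderiv ℝ P z v * P z = fderiv ℝ P z v := by
  classical
  have h := (LinearMap.mul ℝ (Matrix n n ℂ)).toContinuousBilinearMap.hasFDerivAt_of_bilinear
    hP.hasFDerivAt hP.hasFDerivAt
  have h' := h.congr_of_eventuallyEq (f₁ := P) (.of_forall fun y => (hP_idem y).symm)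
  exact (DFunLike.congr_fun h'.fderiv v).symm

/-- If `P * Q = 0` and `A`, `B` satisfy the Leibniz identity of derivatives of an idempotent `P`,
then `P * A * B * Q = 0`. -/
theorem mul_mul_mul_eq_zero_of_leibniz {R : Type*} [Ring R] {P Q A B : R} (hPQ : P * Q = 0)
    (hA : P * A + A * P = A) (hB : P * B + B * P = B) : P * (A * B) * Q = 0 := by
  calc P * (A * B) * Q = (P * A + A * P) * B * Q - A * (P * B + B * P) * Q + A * B * (P * Q) := by
        noncomm_ring
    _ = 0 := by rw [hA, hB, hPQ]; noncomm_ring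

/-- Identity used in Section 5 of the paper: if `P, Q` are continuously
differentiable matrix-functions of `(x,ξ) ∈ ℝᵈ × ℝᵈ` with `P² = P` and
`P Q = 0` everywhere, then `P {P,P} Q = 0` at every point, where
`{P,P} = ∑_α (∂_{x^α}P ∂_{ξ_α}P − ∂_{ξ_α}P ∂_{x^α}P)`. -/
theorem projection_poisson_bracket_orthogonality
    (d m : ℕ)
    (P Q : (Fin d → ℝ) × (Fin d → ℝ) → Matrix (Fin m) (Fin m) ℂ)
    (hP_smooth : ContDiff ℝ 1 P)
    (hQ_smooth : ContDiff ℝ 1 Q)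
    (hP_idem : ∀ z, P z * P z = P z)
    (hPQ : ∀ z, P z * Q z = 0)
    (z : (Fin d → ℝ) × (Fin d → ℝ)) :
    P z * (∑ α : Fin d,
        (fderiv ℝ P z (Pi.single α 1, 0) * fderiv ℝ P z (0, Pi.single α 1)
          - fderiv ℝ P z (0, Pi.single α 1) * fderiv ℝ P z (Pi.single α 1, 0)))
      * Q z = 0 := by
  have hP := (hP_smooth.differentiable one_ne_zero) z
  have key := fun v w => mul_mul_mul_eq_zero_of_leibniz (hPQ z)
    (fderiv_eq_of_idempotent hP hP_idem v) (fderiv_eq_of_idempotent hP hP_idem w)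
  rw [Finset.mul_sum, Finset.sum_mul]
  refine Finset.sum_eq_zero fun α _ => ?_
  rw [mul_sub, sub_mul, key, key, sub_zero]
end
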